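/- Let A ∈ ℝ^{m×d}, B ∈ ℝ^{ℓ×d}, v ∈ S^{d-1}, f(v) = ‖Av‖²/‖Bv‖², and H(v) = AᵀA − f(v)BᵀB. Then for x uniform on S^{d-1}: E[(‖Ax‖² − f(v)‖Bx‖²)(xxᵀ − (1/(d+2))I_d)] = (2/(d(d+2)))·H(v). -/

import Mathlib

open Matrix MeasureTheory Metric RealInnerProductSpace

/-- The uniform (normalized surface) probability measure on the unit sphere in `ℝ^d`. -/
noncomputable def sphereUniform (d : ℕ) :
    Measure (sphere (0 : EuclideanSpace ℝ (Fin d)) 1) :=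
  (((volume : Measure (EuclideanSpace ℝ (Fin d))).toSphere Set.univ)⁻¹) •
    (volume : Measure (EuclideanSpace ℝ (Fin d))).toSphere

/-- The generalized Rayleigh quotient `f(v) = ‖Av‖²/‖Bv‖²`. -/
noncomputable def genRayleigh {m l d : ℕ} (A : Matrix (Fin m) (Fin d) ℝ)
    (B : Matrix (Fin l) (Fin d) ℝ) (v : EuclideanSpace ℝ (Fin d)) : ℝ :=
  ‖Matrix.toEuclideanLin A v‖ ^ 2 / ‖Matrix.toEuclideanLin B v‖ ^ 2

open scoped Pointwise

section SphereMoments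

variable {E : Type*} [NormedAddCommGroup E] [InnerProductSpace ℝ E]

/-- The action of a linear isometric automorphism on the unit sphere. -/
def LinearIsometryEquiv.sphereMap (U : E ≃ₗᵢ[ℝ] E) (x : sphere (0 : E) 1) : sphere (0 : E) 1 :=
  ⟨U x, by simp⟩

@[simp]
theorem LinearIsometryEquiv.coe_sphereMap (U : E ≃ₗᵢ[ℝ] E) (x : sphere (0 : E) 1) :
    (U.sphereMap x : E) = U x := rfl

theorem LinearIsometryEquiv.continuous_sphereMap (U : E ≃ₗᵢ[ℝ] E) :
    Continuous U.sphereMap :=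
  (U.continuous.comp continuous_subtype_val).subtype_mk _

theorem LinearIsometryEquiv.smul_coe_image_sphereMap_preimage (U : E ≃ₗᵢ[ℝ] E)
    (R : Set ℝ) (s : Set (sphere (0 : E) 1)) :
    R • (Subtype.val '' (U.sphereMap ⁻¹' s)) = U ⁻¹' (R • (Subtype.val '' s)) := by
  ext y
  simp only [Set.mem_smul, Set.mem_image, Set.mem_preimage]
  constructor
  · rintro ⟨r, hr, _, ⟨x, hx, rfl⟩, rfl⟩
    exact ⟨r, hr, _, ⟨_, hx, rfl⟩, by simp⟩
  · rintro ⟨r, hr, _, ⟨x, hx, rfl⟩, h⟩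
    refine ⟨r, hr, _, ⟨U.symm.sphereMap x, ?_, rfl⟩, U.injective ?_⟩
    · convert hx
      ext
      simp
    · simp [h]

variable [MeasurableSpace E] [BorelSpace E]

variable {ν : Measure (sphere (0 : E) 1)}

theorem integral_inner_pow_eq_of_norm_eq
    (hν : ∀ U : E ≃ₗᵢ[ℝ] E, MeasurePreserving U.sphereMap ν ν) (n : ℕ) {u w : E}
    (h : ‖u‖ = ‖w‖) :
    ∫ x, ⟪u, (x : E)⟫ ^ n ∂ν = ∫ x, ⟪w, (x : E)⟫ ^ n ∂ν := by
  set U : E ≃ₗᵢ[ℝ] E := (ℝ ∙ (u - w))ᗮ.reflection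
  have hU : U u = w := Submodule.reflection_sub h
  have hc : Continuous fun x : sphere (0 : E) 1 => ⟪w, (x : E)⟫ ^ n := by fun_prop
  calc ∫ x, ⟪u, (x : E)⟫ ^ n ∂ν = ∫ x, ⟪w, (U.sphereMap x : E)⟫ ^ n ∂ν := by
        simp [← hU]
    _ = ∫ x, ⟪w, (x : E)⟫ ^ n ∂(ν.map U.sphereMap) :=
        (integral_map U.continuous_sphereMap.measurable.aemeasurable
          hc.aestronglyMeasurable).symm
    _ = ∫ x, ⟪w, (x : E)⟫ ^ n ∂ν := by rw [(hν U).map_eq]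

theorem exists_integral_inner_pow_four_eq [Nontrivial E]
    (hν : ∀ U : E ≃ₗᵢ[ℝ] E, MeasurePreserving U.sphereMap ν ν) :
    ∃ c : ℝ, ∀ u : E, ∫ x, ⟪u, (x : E)⟫ ^ 4 ∂ν = c * ⟪u, u⟫ ^ 2 := by
  obtain ⟨e, he⟩ := exists_norm_eq E zero_le_one
  refine ⟨∫ x, ⟪e, (x : E)⟫ ^ 4 ∂ν, fun u => ?_⟩
  rw [integral_inner_pow_eq_of_norm_eq hν 4 (w := ‖u‖ • e) (by simp [norm_smul, he])]
  simp only [inner_smul_left, mul_pow, integral_const_mul, real_inner_self_eq_norm_sq]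
  simp
  ring

variable [FiniteDimensional ℝ E]

theorem LinearIsometryEquiv.measurePreserving_sphereMap_toSphere (U : E ≃ₗᵢ[ℝ] E) :
    MeasurePreserving U.sphereMap (volume : Measure E).toSphere (volume : Measure E).toSphere := by
  refine ⟨U.continuous_sphereMap.measurable, Measure.ext fun s hs => ?_⟩
  have hU : MeasurableSet (U.sphereMap ⁻¹' s) := U.continuous_sphereMap.measurable hs
  rw [Measure.map_apply U.continuous_sphereMap.measurable hs, Measure.toSphere_apply' _ hU,
    Measure.toSphere_apply' _ hs, U.smul_coe_image_sphereMap_preimage]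
  exact congrArg _ (U.measurePreserving.measure_preimage_equiv (f := U.toMeasurableEquiv) _)

theorem integrable_sphere_of_continuous [IsFiniteMeasure ν] {f : sphere (0 : E) 1 → ℝ}
    (hf : Continuous f) : Integrable f ν :=
  hf.integrable_of_hasCompactSupport (HasCompactSupport.of_compactSpace f)

/-- The fourth moments of a rotation-invariant measure on the unit sphere. -/
theorem exists_integral_inner_mul_inner_eq [Nontrivial E] [IsFiniteMeasure ν]
    (hν : ∀ U : E ≃ₗᵢ[ℝ] E, MeasurePreserving U.sphereMap ν ν) :
    ∃ κ : ℝ, ∀ a b c d : E,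
      ∫ x, ⟪a, (x : E)⟫ * ⟪b, (x : E)⟫ * (⟪c, (x : E)⟫ * ⟪d, (x : E)⟫) ∂ν
        = κ * (⟪a, b⟫ * ⟪c, d⟫ + ⟪a, c⟫ * ⟪b, d⟫ + ⟪a, d⟫ * ⟪b, c⟫) := by
  obtain ⟨q, hq⟩ := exists_integral_inner_pow_four_eq hν
  refine ⟨q / 3, fun a b c d => ?_⟩
  have hi (u : E) : Integrable (fun x : sphere (0 : E) 1 => ⟪u, (x : E)⟫ ^ 4) ν :=
    integrable_sphere_of_continuous (by fun_prop)
  have polarization (x : sphere (0 : E) 1) :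
      ⟪a, (x : E)⟫ * ⟪b, (x : E)⟫ * (⟪c, (x : E)⟫ * ⟪d, (x : E)⟫) =
        (⟪a + b + c + d, (x : E)⟫ ^ 4 - ⟪a + b + c - d, (x : E)⟫ ^ 4
          - ⟪a + b - c + d, (x : E)⟫ ^ 4 + ⟪a + b - c - d, (x : E)⟫ ^ 4
          - ⟪a - b + c + d, (x : E)⟫ ^ 4 + ⟪a - b + c - d, (x : E)⟫ ^ 4
          + ⟪a - b - c + d, (x : E)⟫ ^ 4 - ⟪a - b - c - d, (x : E)⟫ ^ 4) / 192 := by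
    simp only [inner_add_left, inner_sub_left]
    ring
  simp_rw [polarization]
  rw [integral_div, integral_sub (by fun_prop) (by fun_prop),
    integral_add (by fun_prop) (by fun_prop), integral_add (by fun_prop) (by fun_prop),
    integral_sub (by fun_prop) (by fun_prop),
    integral_add (by fun_prop) (by fun_prop),
    integral_sub (by fun_prop) (by fun_prop),
    integral_sub (by fun_prop) (by fun_prop)]
  simp only [hq]
  simp only [inner_add_left, inner_sub_left, inner_add_right, inner_sub_right]
  rw [real_inner_comm a b, real_inner_comm a c, real_inner_comm a d, real_inner_comm b c,
    real_inner_comm b d, real_inner_comm c d]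
  ring

end SphereMoments

section SphereUniform

variable {d : ℕ}

instance [NeZero d] : IsProbabilityMeasure (sphereUniform d) := by
  constructor
  rw [sphereUniform, Measure.smul_apply, smul_eq_mul]
  refine ENNReal.inv_mul_cancel ?_ (measure_ne_top _ _)
  exact Measure.measure_univ_ne_zero.2 (Measure.toSphere_ne_zero _)

theorem measurePreserving_sphereMap_sphereUniform
    (U : EuclideanSpace ℝ (Fin d) ≃ₗᵢ[ℝ] EuclideanSpace ℝ (Fin d)) :
    MeasurePreserving U.sphereMap (sphereUniform d) (sphereUniform d) :=
  U.measurePreserving_sphereMap_toSphere.smul_measure _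

theorem sum_sq_coord_sphere (x : sphere (0 : EuclideanSpace ℝ (Fin d)) 1) :
    ∑ k, x.1 k * x.1 k = 1 := by
  have h := EuclideanSpace.real_norm_sq_eq x.1
  rw [norm_eq_of_mem_sphere x] at h
  simpa [sq] using h.symm

theorem integral_coord_mul_coord_sphereUniform [NeZero d] (k l i j : Fin d) :
    ∫ x, x.1 k * x.1 l * (x.1 i * x.1 j) ∂(sphereUniform d)
      = ((d : ℝ) * (d + 2))⁻¹ * ((if k = l then 1 else 0) * (if i = j then 1 else 0)
        + (if k = i then 1 else 0) * (if l = j then 1 else 0)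
        + (if k = j then 1 else 0) * (if l = i then 1 else 0)) := by
  obtain ⟨κ, hκ⟩ := exists_integral_inner_mul_inner_eq
    (measurePreserving_sphereMap_sphereUniform (d := d))
  have moment (k l i j : Fin d) :
      ∫ x, x.1 k * x.1 l * (x.1 i * x.1 j) ∂(sphereUniform d)
        = κ * ((if k = l then 1 else 0) * (if i = j then 1 else 0)
          + (if k = i then 1 else 0) * (if l = j then 1 else 0)
          + (if k = j then 1 else 0) * (if l = i then 1 else 0)) := by
    simpa [EuclideanSpace.inner_single_left, PiLp.single_apply] using
      hκ (EuclideanSpace.single k 1) (EuclideanSpace.single l 1)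
        (EuclideanSpace.single i 1) (EuclideanSpace.single j 1)
  have total : ∑ k : Fin d, ∑ i : Fin d,
      ∫ x, x.1 k * x.1 k * (x.1 i * x.1 i) ∂(sphereUniform d) = 1 := by
    have hi (k i : Fin d) : Integrable (fun x : sphere (0 : EuclideanSpace ℝ (Fin d)) 1 =>
        x.1 k * x.1 k * (x.1 i * x.1 i)) (sphereUniform d) :=
      integrable_sphere_of_continuous (by fun_prop)
    simp_rw [← integral_finsetSum _ fun i _ => hi _ i]
    rw [← integral_finsetSum _ fun k _ => integrable_finsetSum _ fun i _ => hi k i]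
    simp_rw [← Finset.mul_sum, sum_sq_coord_sphere, mul_one, sum_sq_coord_sphere]
    simp
  have hκd : κ * ((d : ℝ) * (d + 2)) = 1 := by
    simp only [moment] at total
    rw [← total]
    simp [← Finset.mul_sum, Finset.sum_add_distrib]
    ring
  rw [moment, eq_inv_of_mul_eq_one_left hκd]

theorem integral_coord_mul_coord_sub_sphereUniform (k l i j : Fin d) :
    ∫ x, x.1 k * x.1 l * (x.1 i * x.1 j - if i = j then ((d : ℝ) + 2)⁻¹ else 0)
        ∂(sphereUniform d)
      = ((d : ℝ) * (d + 2))⁻¹ * ((if k = i then 1 else 0) * (if l = j then 1 else 0)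
        + (if k = j then 1 else 0) * (if l = i then 1 else 0)) := by
  have : NeZero d := ⟨i.pos.ne'⟩
  have hi (i j : Fin d) : Integrable (fun x : sphere (0 : EuclideanSpace ℝ (Fin d)) 1 =>
      x.1 k * x.1 l * (x.1 i * x.1 j)) (sphereUniform d) :=
    integrable_sphere_of_continuous (by fun_prop)
  have second_moment : ∫ x, x.1 k * x.1 l ∂(sphereUniform d)
      = ((d : ℝ) * (d + 2))⁻¹ * ((d + 2) * if k = l then 1 else 0) := by
    calc ∫ x, x.1 k * x.1 l ∂(sphereUniform d)
        = ∑ p, ∫ x, x.1 k * x.1 l * (x.1 p * x.1 p) ∂(sphereUniform d) := by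
          rw [← integral_finsetSum _ fun p _ => hi p p]
          simp_rw [← Finset.mul_sum, sum_sq_coord_sphere, mul_one]
      _ = _ := by
          simp only [integral_coord_mul_coord_sphereUniform, ← Finset.mul_sum,
            Finset.sum_add_distrib]
          simp [eq_comm (a := l)]
          split_ifs <;> ring
  have h2 : Integrable (fun x : sphere (0 : EuclideanSpace ℝ (Fin d)) 1 =>
      x.1 k * x.1 l * if i = j then ((d : ℝ) + 2)⁻¹ else 0) (sphereUniform d) :=
    integrable_sphere_of_continuous (by fun_prop)
  simp_rw [mul_sub]
  rw [integral_sub (hi i j) h2, integral_mul_const, second_moment,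
    integral_coord_mul_coord_sphereUniform]
  split_ifs <;> field_simp <;> ring

/-- Integrating a symmetric quadratic form against `x xᵀ - (d + 2)⁻¹ I` recovers its matrix. -/
theorem integral_quadratic_mul_sphereUniform {C : Matrix (Fin d) (Fin d) ℝ} (hC : C.IsSymm)
    (i j : Fin d) :
    ∫ x, (∑ k, ∑ l, C k l * (x.1 k * x.1 l))
        * (x.1 i * x.1 j - if i = j then ((d : ℝ) + 2)⁻¹ else 0) ∂(sphereUniform d)
      = 2 / (d * (d + 2)) * C i j := by
  have : NeZero d := ⟨i.pos.ne'⟩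
  have hi (k l : Fin d) : Integrable (fun x : sphere (0 : EuclideanSpace ℝ (Fin d)) 1 =>
      C k l * (x.1 k * x.1 l * (x.1 i * x.1 j - if i = j then ((d : ℝ) + 2)⁻¹ else 0)))
      (sphereUniform d) :=
    integrable_sphere_of_continuous (by fun_prop)
  simp_rw [Finset.sum_mul, mul_assoc (C _ _)]
  rw [integral_finsetSum _ fun k _ => integrable_finsetSum _ fun l _ => hi k l]
  simp_rw [integral_finsetSum _ fun l _ => hi _ l, integral_const_mul,
    integral_coord_mul_coord_sub_sphereUniform]
  have hji : C j i = C i j := hC.apply i j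
  simp [mul_add, Finset.sum_add_distrib, hji]
  ring

theorem norm_toEuclideanLin_sq {m : ℕ} (A : Matrix (Fin m) (Fin d) ℝ)
    (x : EuclideanSpace ℝ (Fin d)) :
    ‖Matrix.toEuclideanLin A x‖ ^ 2 = ∑ k, ∑ l, (Aᴴ * A) k l * (x k * x l) := by
  rw [EuclideanSpace.real_norm_sq_eq]
  simp only [Matrix.toLpLin_apply, Matrix.mulVec, dotProduct, sq, Finset.sum_mul,
    Finset.mul_sum, Matrix.mul_apply, conjTranspose_apply, star_trivial]
  rw [Finset.sum_comm]
  refine Finset.sum_congr rfl fun k _ => ?_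
  rw [Finset.sum_comm]
  refine Finset.sum_congr rfl fun l _ => Finset.sum_congr rfl fun p _ => ?_
  ring

end SphereUniform

theorem stmt18 {m l d : ℕ} (A : Matrix (Fin m) (Fin d) ℝ) (B : Matrix (Fin l) (Fin d) ℝ)
    (hB : (Bᴴ * B).PosDef) (v : EuclideanSpace ℝ (Fin d)) (hv : ‖v‖ = 1) :
    ∀ i j : Fin d,
      ∫ x : sphere (0 : EuclideanSpace ℝ (Fin d)) 1,
          (‖Matrix.toEuclideanLin A x‖ ^ 2 - genRayleigh A B v * ‖Matrix.toEuclideanLin B x‖ ^ 2)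
            * ((x : EuclideanSpace ℝ (Fin d)) i * (x : EuclideanSpace ℝ (Fin d)) j
              - (if i = j then ((d : ℝ) + 2)⁻¹ else 0))
          ∂(sphereUniform d)
        = (2 / (d * (d + 2))) * ((Aᴴ * A) i j - genRayleigh A B v * (Bᴴ * B) i j) := by
  intro i j
  set f := genRayleigh A B v
  have hC : (Aᴴ * A - f • (Bᴴ * B)).IsSymm := by
    simp [Matrix.IsSymm, conjTranspose_eq_transpose_of_trivial]
  rw [← smul_eq_mul f, ← Matrix.smul_apply, ← Matrix.sub_apply,
    ← integral_quadratic_mul_sphereUniform hC]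
  simp only [norm_toEuclideanLin_sq, Finset.mul_sum, ← Finset.sum_sub_distrib, Matrix.sub_apply,
    Matrix.smul_apply, smul_eq_mul, sub_mul, mul_assoc]
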